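/- Let π be a permutation of ZZ_2^3 with π(0) = 0. Then its signature σ, defined by σ(x) = Σ_{y ∈ ZZ_2^3, ⟨x,y⟩ = 0} π(y), is a ZZ_2-linear transformation of ZZ_2^3. If moreover π is antilinear, then σ is regular (invertible), and hence a permutation of ZZ_2^3. -/

import Mathlib

/-- The group `ZZ_2^3`. -/
abbrev V3 := Fin 3 → ZMod 2

/-- A permutation of `ZZ_2^3` is antilinear if it fixes `0` and no three nonzero elements
summing to zero are mapped to three elements summing to zero. -/
def Antilinear (π : Equiv.Perm V3) : Prop :=
  π 0 = 0 ∧ ∀ x y z : V3, x ≠ 0 → y ≠ 0 → z ≠ 0 → x + y + z ≠ 0 ∨ π x + π y + π z ≠ 0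

/-- The standard inner product (dot product mod 2) on `ZZ_2^3`. -/
def dotp (x y : V3) : ZMod 2 := ∑ j, x j * y j

/-- The signature of a permutation of `ZZ_2^3`. -/
def sig (π : Equiv.Perm V3) (x : V3) : V3 :=
  ∑ y ∈ Finset.univ.filter (fun y => dotp x y = 0), π y

/-- A Fano permutation is an antilinear permutation whose signature is the identity. -/
def Fano (π : Equiv.Perm V3) : Prop := Antilinear π ∧ ∀ x, sig π x = x

/-- Identification of `{0,…,7}` with `ZZ_2^3` via binary representation. -/
def ofN (i : Fin 8) : V3 := fun j => if Nat.testBit i.val j.val then 1 else 0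

/-- Identification of `ZZ_2^3` with `{0,…,7}` via binary representation. -/
def toN (x : V3) : Fin 8 :=
  ⟨(x 0).val + 2 * (x 1).val + 4 * (x 2).val, by
    have h0 := ZMod.val_lt (x 0); have h1 := ZMod.val_lt (x 1)
    have h2 := ZMod.val_lt (x 2); omega⟩

/-- The permutation of `ZZ_2^3` described, via the binary identification, by a
table of images of `0,…,7`. -/
noncomputable def permOf (v : Fin 8 → Fin 8) (h : Function.Bijective fun x : V3 => ofN (v (toN x))) :
    Equiv.Perm V3 :=
  Equiv.ofBijective _ h
theorem sig_eq (π : Equiv.Perm V3) (x : V3) : sig π x = ∑ y, dotp x y • π y := by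
  have hs : ∑ y, π y = 0 := by
    rw [Equiv.sum_comp π (fun y => y)]
    decide
  have key : ∀ c : ZMod 2, ∀ v : V3, (if c = 0 then v else 0) = v + c • v := by decide
  unfold sig
  rw [Finset.sum_filter]
  simp only [key]
  rw [Finset.sum_add_distrib, hs, zero_add]

theorem line_exists : ∀ x : V3, x ≠ 0 → ∃ a b : V3, a ≠ 0 ∧ b ≠ 0 ∧ a ≠ b ∧
    ∀ y, dotp x y = 0 ↔ y = 0 ∨ y = a ∨ y = b ∨ y = a + b := by
  unfold dotp
  decide +kernel

theorem add_facts : ∀ a b : V3, a ≠ b → a + b ≠ 0 ∧ a + b + (a + b) = 0 := by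
  decide +kernel

/-- The signature of a permutation of `ZZ_2^3` fixing `0` is a linear transformation;
if the permutation is moreover antilinear, its signature is regular, hence a permutation. -/
theorem stmt10 (π : Equiv.Perm V3) (h0 : π 0 = 0) :
    IsLinearMap (ZMod 2) (sig π) ∧ (Antilinear π → Function.Bijective (sig π)) := by
  have hlin : IsLinearMap (ZMod 2) (sig π) := by
    constructor
    · intro x y
      simp only [sig_eq, ← Finset.sum_add_distrib, ← add_smul]
      refine Finset.sum_congr rfl fun z _ => ?_
      congr 1
      simp [dotp, add_mul, Finset.sum_add_distrib]
    · intro c x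
      simp only [sig_eq, Finset.smul_sum, smul_smul]
      refine Finset.sum_congr rfl fun z _ => ?_
      congr 1
      simp [dotp, Finset.mul_sum, mul_assoc]
  refine ⟨hlin, fun hA => ?_⟩
  apply Finite.injective_iff_bijective.mp
  have hinj : Function.Injective (hlin.mk' (sig π)) := by
    rw [injective_iff_map_eq_zero]
    intro x hx
    by_contra hne
    obtain ⟨a, b, ha, hb, hab, hy⟩ := line_exists x hne
    obtain ⟨h1, h2⟩ := add_facts a b hab
    have hx' : sig π x = 0 := hx
    have hset : (Finset.univ.filter fun y => dotp x y = 0) = {0, a, b, a + b} := by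
      ext y
      simp [hy]
    unfold sig at hx'
    rw [hset, Finset.sum_insert (by simp [Ne.symm ha, Ne.symm hb, Ne.symm h1]),
      Finset.sum_insert (by simp [hab, hb]),
      Finset.sum_insert (by simp [ha]), Finset.sum_singleton, h0, zero_add,
      ← add_assoc] at hx'
    rcases hA.2 a b (a + b) ha hb h1 with h | h
    · exact h h2
    · exact h hx'
  exact hinj
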